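/- arXiv:2506.20166 — 2 statements merged into one kernel-verified Lean document; each statement's English description precedes it below -/
import Mathlib

section
/- Let θ ∈ (0, π/2) and let y, z ∈ ℝ with y ≠ 0 and |tanh(z·(sin θ)/2)| < |tanh(y·sin(θ/2))|. Write c := cos(θ/2). Then the series below converges and χ(y, z; θ) = (1/2)·sec(θ/2)·[ log| (y + z·c) / (y − z·c) | + Σ_{n=1}^{∞} log( ((y + z·c)² + n²π²/sin²(θ/2)) / ((y − z·c)² + n²π²/sin²(θ/2)) ) ]. -/
open Real Filter

/-- Real inverse hyperbolic tangent. -/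
noncomputable def artanhR (x : ℝ) : ℝ := (1 / 2) * Real.log ((1 + x) / (1 - x))

/-- Height function of Scherk's type Born–Infeld solitons. -/
noncomputable def chi (y z θ : ℝ) : ℝ :=
  (Real.cos (θ / 2))⁻¹ *
    artanhR (Real.tanh (z * Real.sin θ / 2) / Real.tanh (y * Real.sin (θ / 2)))

/-- The Euler product expansion of the hyperbolic sine. -/
theorem Real.tendsto_euler_sinh_prod (u : ℝ) :
    Tendsto (fun N : ℕ => u * ∏ n ∈ Finset.Icc 1 N, (1 + u ^ 2 / ((n : ℝ) ^ 2 * π ^ 2)))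
      atTop (nhds (Real.sinh u)) := by
  have hπ : (π : ℂ) ≠ 0 := Complex.ofReal_ne_zero.mpr pi_ne_zero
  have h := (Complex.tendsto_euler_sin_prod (u * Complex.I / π)).mul_const (-Complex.I)
  rw [mul_div_cancel₀ _ hπ, Complex.sin_mul_I,
    show Complex.sinh u * Complex.I * -Complex.I = Complex.sinh u by
      linear_combination (-Complex.sinh u) * Complex.I_mul_I] at h
  have h' := (Complex.continuous_re.tendsto _).comp h
  rw [Complex.sinh_ofReal_re] at h'
  refine h'.congr fun N => ?_
  have hprod : (u : ℂ) * ∏ n ∈ Finset.Icc 1 N, (1 + (u : ℂ) ^ 2 / ((n : ℂ) ^ 2 * (π : ℂ) ^ 2)) =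
      u * Complex.I *
        (∏ j ∈ Finset.range N, (1 - (u * Complex.I / π) ^ 2 / ((j : ℂ) + 1) ^ 2)) *
          -Complex.I := by
    rw [Finset.range_eq_Ico, ← Finset.Ico_add_one_right_eq_Icc,
      ← Finset.prod_Ico_add' _ 0 N 1]
    have hterm (j : ℕ) : 1 - (u * Complex.I / π) ^ 2 / ((j : ℂ) + 1) ^ 2 =
        1 + (u : ℂ) ^ 2 / (((j + 1 : ℕ) : ℂ) ^ 2 * (π : ℂ) ^ 2) := by
      rw [div_pow, mul_pow, Complex.I_sq, Nat.cast_add_one, div_div]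
      ring
    simp only [hterm]
    linear_combination ((u : ℂ) * ∏ j ∈ Finset.Ico 0 N,
      (1 + (u : ℂ) ^ 2 / (((j + 1 : ℕ) : ℂ) ^ 2 * (π : ℂ) ^ 2))) * Complex.I_mul_I
  rw [Function.comp_apply, ← hprod]
  exact_mod_cast Complex.ofReal_re _

/-- The logarithm of the product expansion of `sinh u / u`. -/
theorem Real.tendsto_sum_log_one_add_sq_div {u : ℝ} (hu : u ≠ 0) :
    Tendsto (fun N : ℕ => ∑ n ∈ Finset.Icc 1 N, log (1 + u ^ 2 / ((n : ℝ) ^ 2 * π ^ 2)))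
      atTop (nhds (log (Real.sinh u) - log u)) := by
  have hs : Real.sinh u ≠ 0 := Real.sinh_ne_zero.mpr hu
  have h := ((Real.tendsto_euler_sinh_prod u).log hs).sub_const (log u)
  refine h.congr fun N => ?_
  have hpos (n : ℕ) : 1 + u ^ 2 / ((n : ℝ) ^ 2 * π ^ 2) ≠ 0 := by positivity
  rw [log_mul hu (Finset.prod_ne_zero_iff.mpr fun n _ => hpos n),
    log_prod fun n _ => hpos n, add_sub_cancel_left]

theorem artanhR_tanh_div_tanh {p q : ℝ} (hq : q ≠ 0) :
    artanhR (Real.tanh p / Real.tanh q) =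
      1 / 2 * log (Real.sinh (q + p) / Real.sinh (q - p)) := by
  have hs : Real.sinh q ≠ 0 := Real.sinh_ne_zero.mpr hq
  have hcp := (Real.cosh_pos p).ne'
  have hcq := (Real.cosh_pos q).ne'
  have hx : Real.tanh p / Real.tanh q =
      Real.cosh q * Real.sinh p / (Real.sinh q * Real.cosh p) := by
    rw [Real.tanh_eq_sinh_div_cosh, Real.tanh_eq_sinh_div_cosh]
    field_simp
  have hd : Real.sinh q * Real.cosh p ≠ 0 := mul_ne_zero hs hcp
  rw [artanhR, hx, Real.sinh_add, Real.sinh_sub, one_add_div hd, one_sub_div hd,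
    div_div_div_cancel_right₀ hd]

/-- Real infinite decomposition of Scherk's type Born–Infeld solitons. -/
theorem scherk_born_infeld_real_decomposition (θ : ℝ) (hθ0 : 0 < θ)
    (hθ1 : θ < Real.pi / 2) (y z : ℝ) (hy : y ≠ 0)
    (hlt : |Real.tanh (z * Real.sin θ / 2)| < |Real.tanh (y * Real.sin (θ / 2))|) :
    ∃ S : ℝ,
      Filter.Tendsto
        (fun N : ℕ => ∑ n ∈ Finset.Icc 1 N,
          Real.log (((y + z * Real.cos (θ / 2)) ^ 2 +
              (n : ℝ) ^ 2 * Real.pi ^ 2 / (Real.sin (θ / 2)) ^ 2) /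
            ((y - z * Real.cos (θ / 2)) ^ 2 +
              (n : ℝ) ^ 2 * Real.pi ^ 2 / (Real.sin (θ / 2)) ^ 2)))
        Filter.atTop (nhds S) ∧
      chi y z θ = (1 / 2) * (Real.cos (θ / 2))⁻¹ *
        (Real.log (|(y + z * Real.cos (θ / 2)) / (y - z * Real.cos (θ / 2))|) + S) := by
  have hsin : 0 < Real.sin (θ / 2) := sin_pos_of_pos_of_lt_pi (by linarith) (by linarith)
  have hp : z * Real.sin θ / 2 = z * Real.cos (θ / 2) * Real.sin (θ / 2) := by
    rw [show θ = 2 * (θ / 2) by ring, Real.sin_two_mul]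
    ring_nf
  rw [chi, artanhR_tanh_div_tanh (mul_ne_zero hy hsin.ne')]
  rw [hp] at hlt ⊢
  generalize Real.sin (θ / 2) = s at *
  rw [← add_mul, ← sub_mul]
  generalize z * Real.cos (θ / 2) = w at *
  have hA : y + w ≠ 0 := by
    intro h
    rw [eq_neg_of_add_eq_zero_left h, neg_mul, Real.tanh_neg, abs_neg] at hlt
    exact hlt.false
  have hB : y - w ≠ 0 := by
    intro h
    rw [sub_eq_zero.mp h] at hlt
    exact hlt.false
  have ha : (y + w) * s ≠ 0 := mul_ne_zero hA hsin.ne'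
  have hb : (y - w) * s ≠ 0 := mul_ne_zero hB hsin.ne'
  refine ⟨_, ((Real.tendsto_sum_log_one_add_sq_div ha).sub
    (Real.tendsto_sum_log_one_add_sq_div hb)).congr fun N => ?_, ?_⟩
  · rw [← Finset.sum_sub_distrib]
    refine Finset.sum_congr rfl fun n hn => ?_
    have hn0 : (n : ℝ) ≠ 0 := by
      have := (Finset.mem_Icc.mp hn).1
      positivity
    rw [← log_div (by positivity) (by positivity)]
    congr 1
    field_simp
    ring
  · rw [log_abs, log_div hA hB, log_div (Real.sinh_ne_zero.mpr ha) (Real.sinh_ne_zero.mpr hb),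
      log_mul hA hsin.ne', log_mul hB hsin.ne']
    ring
end

section
/- Let F : ℂ × ℂ → ℂ be analytic on all of ℂ × ℂ, real-valued at all real arguments, and odd in its second variable, i.e. F(z, −w) = −F(z, w) for all z, w ∈ ℂ. Suppose the real function f(x, y) := F(x, y) (for x, y ∈ ℝ) satisfies the minimal surface equation at every point of ℝ². Then h(y, z) := −i·F(z, i·y) is real for all real y, z, and the resulting real function h satisfies the Born–Infeld equation at every point of ℝ². -/
open Real Complex Filter

/-- Partial derivative with respect to the first variable. -/
noncomputable def partialX (f : ℝ → ℝ → ℝ) (x y : ℝ) : ℝ := deriv (fun t => f t y) x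

/-- Partial derivative with respect to the second variable. -/
noncomputable def partialY (f : ℝ → ℝ → ℝ) (x y : ℝ) : ℝ := deriv (fun t => f x t) y

/-- `f` satisfies the minimal surface equation at `(x, y)`. -/
def SatisfiesMSE (f : ℝ → ℝ → ℝ) (x y : ℝ) : Prop :=
  (1 + (partialX f x y) ^ 2) * partialY (partialY f) x y
    - 2 * partialX f x y * partialY f x y * partialY (partialX f) x y
    + (1 + (partialY f x y) ^ 2) * partialX (partialX f) x y = 0

/-- `g` satisfies the zero mean curvature equation at `(x, y)`. -/
def SatisfiesZMC (g : ℝ → ℝ → ℝ) (x y : ℝ) : Prop :=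
  (1 - (partialX g x y) ^ 2) * partialY (partialY g) x y
    + 2 * partialX g x y * partialY g x y * partialY (partialX g) x y
    + (1 - (partialY g x y) ^ 2) * partialX (partialX g) x y = 0

/-- `h = h(y, z)` (first variable `y`, second variable `z`) satisfies the
Born–Infeld equation at `(y, z)`. -/
def SatisfiesBIE (h : ℝ → ℝ → ℝ) (y z : ℝ) : Prop :=
  (1 + (partialX h y z) ^ 2) * partialY (partialY h) y z
    - 2 * partialX h y z * partialY h y z * partialY (partialX h) y z
    + ((partialY h y z) ^ 2 - 1) * partialX (partialX h) y z = 0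

open scoped Topology ComplexConjugate

/-- The derivative of `G` along the constant vector field `v`. -/
noncomputable def dirDeriv (v : ℂ × ℂ) (G : ℂ × ℂ → ℂ) (p : ℂ × ℂ) : ℂ := fderiv ℂ G p v

/-- `G` takes real values at real points. -/
def RealOnReals (G : ℂ × ℂ → ℂ) : Prop := ∀ x y : ℝ, (G ((x : ℂ), (y : ℂ))).im = 0

/-- The restriction of `G` to real arguments, as a real function. -/
noncomputable def realRestrict (G : ℂ × ℂ → ℂ) (x y : ℝ) : ℝ := (G ((x : ℂ), (y : ℂ))).re

lemma analyticOnNhd_dirDeriv {G : ℂ × ℂ → ℂ} (hG : AnalyticOnNhd ℂ G Set.univ) (v : ℂ × ℂ) :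
    AnalyticOnNhd ℂ (dirDeriv v G) Set.univ :=
  fun p hp => ((ContinuousLinearMap.apply ℂ ℂ v).analyticAt _).comp (hG.fderiv p hp)

lemma differentiable_of_analyticOnNhd_univ {G : ℂ × ℂ → ℂ} (hG : AnalyticOnNhd ℂ G Set.univ) :
    Differentiable ℂ G := fun p => (hG p trivial).differentiableAt

lemma im_eq_zero_and_deriv_re {g : ℝ → ℂ} {g' : ℂ} {t : ℝ} (hg : HasDerivAt g g' t)
    (him : ∀ s, (g s).im = 0) : g'.im = 0 ∧ deriv (fun s => (g s).re) t = g'.re := by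
  have hre : HasDerivAt (fun s => (g s).re) g'.re t :=
    Complex.reCLM.hasFDerivAt.comp_hasDerivAt t hg
  have hi : HasDerivAt (fun s => (g s).im) g'.im t :=
    Complex.imCLM.hasFDerivAt.comp_hasDerivAt t hg
  simp only [him] at hi
  exact ⟨hi.unique (hasDerivAt_const t 0), hre.deriv⟩

lemma hasDerivAt_fst {G : ℂ × ℂ → ℂ} (hG : Differentiable ℂ G) (x y : ℝ) :
    HasDerivAt (fun t : ℝ => G ((t : ℂ), (y : ℂ))) (dirDeriv (1, 0) G (x, y)) x := by
  have h : HasDerivAt (fun s : ℂ => (s, (y : ℂ))) ((1 : ℂ), (0 : ℂ)) (x : ℂ) :=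
    (hasDerivAt_id _).prodMk (hasDerivAt_const _ _)
  exact ((hG _).hasFDerivAt.comp_hasDerivAt (x : ℂ) h).comp_ofReal

lemma hasDerivAt_snd {G : ℂ × ℂ → ℂ} (hG : Differentiable ℂ G) (x y : ℝ) :
    HasDerivAt (fun t : ℝ => G ((x : ℂ), (t : ℂ))) (dirDeriv (0, 1) G (x, y)) y := by
  have h : HasDerivAt (fun s : ℂ => ((x : ℂ), s)) ((0 : ℂ), (1 : ℂ)) (y : ℂ) :=
    (hasDerivAt_const _ _).prodMk (hasDerivAt_id _)
  exact ((hG _).hasFDerivAt.comp_hasDerivAt (y : ℂ) h).comp_ofReal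

lemma RealOnReals.dirDeriv_fst {G : ℂ × ℂ → ℂ} (hr : RealOnReals G) (hG : Differentiable ℂ G) :
    RealOnReals (dirDeriv (1, 0) G) := fun x y =>
  (im_eq_zero_and_deriv_re (hasDerivAt_fst hG x y) fun s => hr s y).1

lemma RealOnReals.dirDeriv_snd {G : ℂ × ℂ → ℂ} (hr : RealOnReals G) (hG : Differentiable ℂ G) :
    RealOnReals (dirDeriv (0, 1) G) := fun x y =>
  (im_eq_zero_and_deriv_re (hasDerivAt_snd hG x y) fun s => hr x s).1

lemma RealOnReals.partialX_realRestrict {G : ℂ × ℂ → ℂ} (hr : RealOnReals G)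
    (hG : Differentiable ℂ G) : partialX (realRestrict G) = realRestrict (dirDeriv (1, 0) G) := by
  funext x y
  exact (im_eq_zero_and_deriv_re (hasDerivAt_fst hG x y) fun s => hr s y).2

lemma RealOnReals.partialY_realRestrict {G : ℂ × ℂ → ℂ} (hr : RealOnReals G)
    (hG : Differentiable ℂ G) : partialY (realRestrict G) = realRestrict (dirDeriv (0, 1) G) := by
  funext x y
  exact (im_eq_zero_and_deriv_re (hasDerivAt_snd hG x y) fun s => hr x s).2

lemma RealOnReals.ofReal_realRestrict {G : ℂ × ℂ → ℂ} (hr : RealOnReals G) (x y : ℝ) :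
    ((realRestrict G x y : ℝ) : ℂ) = G (x, y) :=
  Complex.ext rfl (hr x y).symm

/-- The minimal surface operator applied to a holomorphic function of two variables. -/
noncomputable def complexMSE (G : ℂ × ℂ → ℂ) (p : ℂ × ℂ) : ℂ :=
  (1 + (dirDeriv (1, 0) G p) ^ 2) * dirDeriv (0, 1) (dirDeriv (0, 1) G) p
    - 2 * dirDeriv (1, 0) G p * dirDeriv (0, 1) G p * dirDeriv (0, 1) (dirDeriv (1, 0) G) p
    + (1 + (dirDeriv (0, 1) G p) ^ 2) * dirDeriv (1, 0) (dirDeriv (1, 0) G) p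

/-- The Born–Infeld operator applied to a holomorphic function of two variables. -/
noncomputable def complexBIE (G : ℂ × ℂ → ℂ) (p : ℂ × ℂ) : ℂ :=
  (1 + (dirDeriv (1, 0) G p) ^ 2) * dirDeriv (0, 1) (dirDeriv (0, 1) G) p
    - 2 * dirDeriv (1, 0) G p * dirDeriv (0, 1) G p * dirDeriv (0, 1) (dirDeriv (1, 0) G) p
    + ((dirDeriv (0, 1) G p) ^ 2 - 1) * dirDeriv (1, 0) (dirDeriv (1, 0) G) p

lemma RealOnReals.satisfiesMSE_iff {G : ℂ × ℂ → ℂ} (hr : RealOnReals G)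
    (hG : AnalyticOnNhd ℂ G Set.univ) (x y : ℝ) :
    SatisfiesMSE (realRestrict G) x y ↔ complexMSE G (x, y) = 0 := by
  have hd := differentiable_of_analyticOnNhd_univ hG
  have hd1 := differentiable_of_analyticOnNhd_univ (analyticOnNhd_dirDeriv hG (1, 0))
  have hd2 := differentiable_of_analyticOnNhd_univ (analyticOnNhd_dirDeriv hG (0, 1))
  have hr1 := hr.dirDeriv_fst hd
  have hr2 := hr.dirDeriv_snd hd
  rw [SatisfiesMSE, complexMSE, hr.partialX_realRestrict hd, hr.partialY_realRestrict hd,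
    hr1.partialX_realRestrict hd1, hr1.partialY_realRestrict hd1, hr2.partialY_realRestrict hd2,
    ← hr1.ofReal_realRestrict, ← hr2.ofReal_realRestrict, ← (hr1.dirDeriv_fst hd1).ofReal_realRestrict,
    ← (hr1.dirDeriv_snd hd1).ofReal_realRestrict, ← (hr2.dirDeriv_snd hd2).ofReal_realRestrict]
  norm_cast

lemma RealOnReals.satisfiesBIE_iff {G : ℂ × ℂ → ℂ} (hr : RealOnReals G)
    (hG : AnalyticOnNhd ℂ G Set.univ) (x y : ℝ) :
    SatisfiesBIE (realRestrict G) x y ↔ complexBIE G (x, y) = 0 := by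
  have hd := differentiable_of_analyticOnNhd_univ hG
  have hd1 := differentiable_of_analyticOnNhd_univ (analyticOnNhd_dirDeriv hG (1, 0))
  have hd2 := differentiable_of_analyticOnNhd_univ (analyticOnNhd_dirDeriv hG (0, 1))
  have hr1 := hr.dirDeriv_fst hd
  have hr2 := hr.dirDeriv_snd hd
  rw [SatisfiesBIE, complexBIE, hr.partialX_realRestrict hd, hr.partialY_realRestrict hd,
    hr1.partialX_realRestrict hd1, hr1.partialY_realRestrict hd1, hr2.partialY_realRestrict hd2,
    ← hr1.ofReal_realRestrict, ← hr2.ofReal_realRestrict, ← (hr1.dirDeriv_fst hd1).ofReal_realRestrict,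
    ← (hr1.dirDeriv_snd hd1).ofReal_realRestrict, ← (hr2.dirDeriv_snd hd2).ofReal_realRestrict]
  norm_cast

/-- An entire function vanishing on the real line vanishes identically. -/
lemma eq_zero_of_forall_ofReal {g : ℂ → ℂ} (hg : Differentiable ℂ g)
    (h : ∀ t : ℝ, g t = 0) (w : ℂ) : g w = 0 := by
  have hA : AnalyticOnNhd ℂ g Set.univ := fun z _ => hg.analyticAt z
  have hfreq : ∃ᶠ z in 𝓝[≠] (0 : ℂ), g z = 0 := by
    have ht : Tendsto (fun t : ℝ => (t : ℂ)) (𝓝[≠] (0 : ℝ)) (𝓝[≠] (0 : ℂ)) := by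
      refine tendsto_nhdsWithin_iff.2 ⟨?_, ?_⟩
      · simpa using (Complex.continuous_ofReal.tendsto 0).mono_left nhdsWithin_le_nhds
      · filter_upwards [self_mem_nhdsWithin] with t ht
        simpa using ht
    exact ht.frequently (Eventually.of_forall h).frequently
  exact hA.eqOn_zero_of_preconnected_of_frequently_eq_zero isPreconnected_univ trivial hfreq
    (Set.mem_univ w)

/-- Schwarz reflection in the second variable, at a real value of the first one. -/
lemma RealOnReals.apply_conj_snd {G : ℂ × ℂ → ℂ} (hr : RealOnReals G) (hG : Differentiable ℂ G)
    (x : ℝ) (w : ℂ) : G (x, conj w) = conj (G (x, w)) := by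
  have hs : Differentiable ℂ fun w => G ((x : ℂ), w) := by fun_prop
  have hc : Differentiable ℂ fun w => conj (G ((x : ℂ), conj w)) := fun w => by
    simpa [Function.comp_def] using (hs (conj w)).conj_conj
  have h := eq_zero_of_forall_ofReal (hs.sub hc)
    (fun t => by
      simp [Pi.sub_apply, Complex.conj_eq_iff_im.2 (hr x t)]) (conj w)
  simpa [sub_eq_zero] using h

/-- The Wick rotation of `G` in the second variable, with the variables interchanged, multiplied
by `c`. -/
noncomputable def wick (c : ℂ) (G : ℂ × ℂ → ℂ) (p : ℂ × ℂ) : ℂ := c * G (p.2, Complex.I * p.1)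

lemma analyticOnNhd_wick (c : ℂ) {G : ℂ × ℂ → ℂ} (hG : AnalyticOnNhd ℂ G Set.univ) :
    AnalyticOnNhd ℂ (wick c G) Set.univ := fun p _ =>
  analyticAt_const.mul <| (hG (p.2, Complex.I * p.1) trivial).fun_comp_of_eq
    (AnalyticAt.prod analyticAt_snd (analyticAt_const.mul analyticAt_fst)) rfl

lemma dirDeriv_wick (c : ℂ) {G : ℂ × ℂ → ℂ} (hG : Differentiable ℂ G) (p : ℂ × ℂ) (v : ℂ × ℂ) :
    dirDeriv v (wick c G) p =
      c * dirDeriv (v.2, Complex.I * v.1) G (p.2, Complex.I * p.1) := by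
  have h : HasFDerivAt (fun q : ℂ × ℂ => (q.2, Complex.I * q.1))
      ((ContinuousLinearMap.snd ℂ ℂ ℂ).prod (Complex.I • ContinuousLinearMap.fst ℂ ℂ ℂ)) p :=
    hasFDerivAt_snd.prodMk (hasFDerivAt_fst.const_smul Complex.I)
  have h2 := ((hG (p.2, Complex.I * p.1)).hasFDerivAt.comp p h).const_smul c
  have h3 : HasFDerivAt (wick c G) _ p := h2
  rw [dirDeriv, h3.fderiv]
  simp [dirDeriv]

lemma dirDeriv_wick_fst (c : ℂ) {G : ℂ × ℂ → ℂ} (hG : Differentiable ℂ G) :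
    dirDeriv (1, 0) (wick c G) = wick (c * Complex.I) (dirDeriv (0, 1) G) := by
  funext p
  have hv : ((0 : ℂ), Complex.I * 1) = Complex.I • ((0 : ℂ), (1 : ℂ)) := by simp
  rw [dirDeriv_wick c hG, hv, wick, dirDeriv, dirDeriv, map_smul, smul_eq_mul, mul_assoc]

lemma dirDeriv_wick_snd (c : ℂ) {G : ℂ × ℂ → ℂ} (hG : Differentiable ℂ G) :
    dirDeriv (0, 1) (wick c G) = wick c (dirDeriv (1, 0) G) := by
  funext p
  rw [dirDeriv_wick c hG, mul_zero, wick]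

lemma dirDeriv_comm {G : ℂ × ℂ → ℂ} (hG : AnalyticOnNhd ℂ G Set.univ) (v w : ℂ × ℂ) :
    dirDeriv v (dirDeriv w G) = dirDeriv w (dirDeriv v G) := by
  have key (v w p : ℂ × ℂ) : dirDeriv v (dirDeriv w G) p = fderiv ℂ (fderiv ℂ G) p v w := by
    have h := (ContinuousLinearMap.apply ℂ ℂ w).hasFDerivAt.comp p
      (hG.fderiv p trivial).differentiableAt.hasFDerivAt
    have h' : HasFDerivAt (dirDeriv w G) _ p := h
    rw [dirDeriv, h'.fderiv]
    rfl
  funext p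
  rw [key, key]
  exact second_derivative_symmetric
    (fun q => (differentiable_of_analyticOnNhd_univ hG q).hasFDerivAt)
    (hG.fderiv p trivial).differentiableAt.hasFDerivAt v w

lemma complexBIE_wick {G : ℂ × ℂ → ℂ} (hG : AnalyticOnNhd ℂ G Set.univ) (p : ℂ × ℂ) :
    complexBIE (wick (-Complex.I) G) p = wick (-Complex.I) (complexMSE G) p := by
  have hd := differentiable_of_analyticOnNhd_univ hG
  have hd1 := differentiable_of_analyticOnNhd_univ (analyticOnNhd_dirDeriv hG (1, 0))
  have hd2 := differentiable_of_analyticOnNhd_univ (analyticOnNhd_dirDeriv hG (0, 1))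
  simp only [complexBIE, dirDeriv_wick_fst _ hd, dirDeriv_wick_snd _ hd, dirDeriv_wick_fst _ hd2,
    dirDeriv_wick_snd _ hd1, dirDeriv_wick_snd _ hd2, dirDeriv_comm hG (1, 0) (0, 1), wick,
    complexMSE, neg_mul, Complex.I_mul_I, neg_neg, one_mul, neg_sq, mul_pow, Complex.I_sq]
  ring

lemma differentiable_complexMSE {G : ℂ × ℂ → ℂ} (hG : AnalyticOnNhd ℂ G Set.univ) :
    Differentiable ℂ (complexMSE G) := by
  have hd1 := analyticOnNhd_dirDeriv hG (1, 0)
  have hd2 := analyticOnNhd_dirDeriv hG (0, 1)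
  have h1 := differentiable_of_analyticOnNhd_univ hd1
  have h2 := differentiable_of_analyticOnNhd_univ hd2
  have h11 := differentiable_of_analyticOnNhd_univ (analyticOnNhd_dirDeriv hd1 (1, 0))
  have h12 := differentiable_of_analyticOnNhd_univ (analyticOnNhd_dirDeriv hd1 (0, 1))
  have h22 := differentiable_of_analyticOnNhd_univ (analyticOnNhd_dirDeriv hd2 (0, 1))
  unfold complexMSE
  fun_prop

/-- Wick rotation of a solution of the minimal surface equation that is odd in the
second variable gives a real solution of the Born–Infeld equation. -/
theorem wick_odd_minimal_to_born_infeld (F : ℂ × ℂ → ℂ)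
    (hF : AnalyticOnNhd ℂ F Set.univ)
    (hreal : ∀ x y : ℝ, (F ((x : ℂ), (y : ℂ))).im = 0)
    (hodd : ∀ z w : ℂ, F (z, -w) = -F (z, w))
    (hmin : ∀ x y : ℝ, SatisfiesMSE (fun x y : ℝ => (F ((x : ℂ), (y : ℂ))).re) x y) :
    (∀ y z : ℝ, ((-Complex.I) * F ((z : ℂ), Complex.I * y)).im = 0) ∧
    (∀ y z : ℝ,
      SatisfiesBIE (fun y z : ℝ => ((-Complex.I) * F ((z : ℂ), Complex.I * y)).re) y z) := by
  have hd := differentiable_of_analyticOnNhd_univ hF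
  have hr : RealOnReals F := hreal
  have hw : RealOnReals (wick (-Complex.I) F) := fun y z => by
    have h := hr.apply_conj_snd hd z (Complex.I * y)
    rw [map_mul, Complex.conj_I, Complex.conj_ofReal, neg_mul, hodd] at h
    have h' := congrArg Complex.re h
    rw [Complex.neg_re, Complex.conj_re] at h'
    simp only [wick, neg_mul, Complex.neg_im, Complex.I_mul_im]
    linarith
  refine ⟨fun y z => hw y z, fun y z => ?_⟩
  refine (hw.satisfiesBIE_iff (analyticOnNhd_wick _ hF) y z).2 ?_
  have hs : Differentiable ℂ fun w => complexMSE F ((z : ℂ), w) := by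
    have := differentiable_complexMSE hF
    fun_prop
  rw [complexBIE_wick hF, wick,
    eq_zero_of_forall_ofReal hs (fun t => (hr.satisfiesMSE_iff hF z t).1 (hmin z t)), mul_zero]
end
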